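/- Simulation property: Let aut be an automaton over syntactic configurations that is synt_step_image_closed. Suppose the syntactic configuration (lc, b) is a node of aut, and the small-step semantics makes a step ((lc, b), s) → ((lc', b'), s'). Then (lc', b') is a node of aut, and the automaton semantics makes the corresponding step aut ⊢ ((lc, b), s) → ((lc', b'), s') (the correspondence relation ≈ between semantic configurations and automaton states being plain equality). -/

import Mathlib

/-! Language: values, expressions, statements, zipper paths -/

abbrev vname := String

inductive val where
  | Bool : Bool → val
  | Null : val
deriving DecidableEq

inductive expr where
  | Val : val → expr
  | Var : vname → expr
deriving DecidableEq

inductive stmt where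
  | Empty : stmt
  | Assign : vname → val → stmt
  | Seq : stmt → stmt → stmt
  | Cond : expr → stmt → stmt → stmt
  | While : expr → stmt → stmt
deriving DecidableEq

inductive stmt_path where
  | PTop : stmt_path
  | PSeqLeft : stmt_path → stmt → stmt_path
  | PSeqRight : stmt → stmt_path → stmt_path
  | PCondLeft : expr → stmt_path → stmt → stmt_path
  | PCondRight : expr → stmt → stmt_path → stmt_path
  | PWhile : expr → stmt_path → stmt_path
deriving DecidableEq

inductive stmt_location where
  | Loc : stmt → stmt_path → stmt_location
deriving DecidableEq

abbrev synt_config := stmt_location × Bool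

abbrev state := vname → Option val

def eval : expr → state → val
  | expr.Val v, _ => v
  | expr.Var x, s => (s x).getD val.Null

open stmt stmt_path stmt_location

def next_loc : stmt → stmt_path → stmt_location × Bool
  | c, PTop => (Loc c PTop, false)
  | c, PSeqLeft sp c2 => (Loc c2 (PSeqRight c sp), true)
  | c, PSeqRight c1 sp => (Loc (Seq c1 c) sp, false)
  | c, PCondLeft e sp c2 => (Loc (Cond e c c2) sp, false)
  | c, PCondRight e c1 sp => (Loc (Cond e c1 c) sp, false)
  | c, PWhile e sp => (Loc (While e c) sp, true)

/-- Small-step operational semantics on semantic configurations. -/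
inductive smallStep : synt_config × state → synt_config × state → Prop where
  | SEmpty (sp : stmt_path) (s : state) :
      smallStep ((Loc Empty sp, true), s) ((Loc Empty sp, false), s)
  | SAssign (vr : vname) (vl : val) (sp : stmt_path) (s : state) :
      smallStep ((Loc (Assign vr vl) sp, true), s)
                ((Loc (Assign vr vl) sp, false), Function.update s vr (some vl))
  | SSeq (c1 c2 : stmt) (sp : stmt_path) (s : state) :
      smallStep ((Loc (Seq c1 c2) sp, true), s) ((Loc c1 (PSeqLeft sp c2), true), s)
  | SCondT (e : expr) (c1 c2 : stmt) (sp : stmt_path) (s : state) :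
      eval e s = val.Bool true →
      smallStep ((Loc (Cond e c1 c2) sp, true), s) ((Loc c1 (PCondLeft e sp c2), true), s)
  | SCondF (e : expr) (c1 c2 : stmt) (sp : stmt_path) (s : state) :
      eval e s = val.Bool false →
      smallStep ((Loc (Cond e c1 c2) sp, true), s) ((Loc c2 (PCondRight e c1 sp), true), s)
  | SWhileT (e : expr) (c : stmt) (sp : stmt_path) (s : state) :
      eval e s = val.Bool true →
      smallStep ((Loc (While e c) sp, true), s) ((Loc c (PWhile e sp), true), s)
  | SWhileF (e : expr) (c : stmt) (sp : stmt_path) (s : state) :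
      eval e s = val.Bool false →
      smallStep ((Loc (While e c) sp, true), s) ((Loc (While e c) sp, false), s)
  | SFalse (c : stmt) (sp : stmt_path) (s : state) :
      sp ≠ PTop →
      smallStep ((Loc c sp, false), s) (next_loc c sp, s)

/-! Automata -/

inductive action where
  | NoAct : action
  | AssAct : vname → val → action
deriving DecidableEq

structure edge (n : Type) where
  source : n
  action : action
  dest : n
deriving DecidableEq

structure ta (n : Type) where
  nodes : List n
  edges : List (edge n)
  init_s : n

def action_effect : action → state → state
  | action.NoAct, s => s
  | action.AssAct x v, s => Function.update s x (some v)

/-- Automaton transition semantics. -/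
def ta_step {n : Type} (aut : ta n) (p q : n × state) : Prop :=
  ∃ e ∈ aut.edges, e.source = p.1 ∧ e.dest = q.1 ∧ q.2 = action_effect e.action p.2

def synt_step_image : synt_config → List synt_config
  | (Loc stmt.Empty sp, true) => [(Loc stmt.Empty sp, false)]
  | (Loc (stmt.Assign vr vl) sp, true) => [(Loc (stmt.Assign vr vl) sp, false)]
  | (Loc (stmt.Seq c1 c2) sp, true) => [(Loc c1 (PSeqLeft sp c2), true)]
  | (Loc (stmt.Cond e c1 c2) sp, true) =>
      [(Loc c1 (PCondLeft e sp c2), true), (Loc c2 (PCondRight e c1 sp), true)]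
  | (Loc (stmt.While e c) sp, true) =>
      [(Loc c (PWhile e sp), true), (Loc (stmt.While e c) sp, false)]
  | (Loc c sp, false) => if sp = PTop then [] else [next_loc c sp]

def action_of_synt_config : synt_config → action
  | (Loc (stmt.Assign vn vl) _, true) => action.AssAct vn vl
  | _ => action.NoAct

def synt_step_image_closed (aut : ta synt_config) : Prop :=
  ∀ n ∈ aut.nodes, ∀ t ∈ synt_step_image n,
    t ∈ aut.nodes ∧
    (⟨n, action_of_synt_config n, t⟩ : edge synt_config) ∈ aut.edges

def all_locations : stmt → stmt_path → List stmt_location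
  | stmt.Empty, sp => [Loc stmt.Empty sp]
  | stmt.Assign vr vl, sp => [Loc (stmt.Assign vr vl) sp]
  | stmt.Seq c1 c2, sp =>
      Loc (stmt.Seq c1 c2) sp ::
        (all_locations c1 (PSeqLeft sp c2) ++ all_locations c2 (PSeqRight c1 sp))
  | stmt.Cond e c1 c2, sp =>
      Loc (stmt.Cond e c1 c2) sp ::
        (all_locations c1 (PCondLeft e sp c2) ++ all_locations c2 (PCondRight e c1 sp))
  | stmt.While e c, sp => Loc (stmt.While e c) sp :: all_locations c (PWhile e sp)

def nodes_of_stmt_locations (ls : List stmt_location) : List synt_config :=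
  ls.flatMap (fun l => [(l, true), (l, false)])

def edge_of_synt_config (s : synt_config) : List (edge synt_config) :=
  (synt_step_image s).map (fun t => ⟨s, action_of_synt_config s, t⟩)

def edges_of_nodes (nds : List synt_config) : List (edge synt_config) :=
  nds.flatMap edge_of_synt_config

def stmt_to_ta (c : stmt) : ta synt_config :=
  let nds := nodes_of_stmt_locations (all_locations c PTop)
  ⟨nds, edges_of_nodes nds, (Loc c PTop, true)⟩

theorem smallStep.mem_synt_step_image_and_effect {p q : synt_config × state}
    (h : smallStep p q) :
    q.1 ∈ synt_step_image p.1 ∧ q.2 = action_effect (action_of_synt_config p.1) p.2 := by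
  cases h with
  | SFalse c sp s hsp =>
    cases c <;> simp [synt_step_image, action_of_synt_config, action_effect, hsp]
  | _ => simp [synt_step_image, action_of_synt_config, action_effect]

/-- Simulation property: if `aut` is `synt_step_image_closed`,
`(lc, b)` is a node of `aut`, and the small-step semantics makes a step
`((lc, b), s) → ((lc', b'), s')`, then `(lc', b')` is a node of `aut` and the
automaton makes the corresponding step. -/
theorem simulation_sem_aut
    (aut : ta synt_config)
    (lc : stmt_location) (b : Bool) (s : state)
    (lc' : stmt_location) (b' : Bool) (s' : state)
    (hclosed : synt_step_image_closed aut)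
    (hnode : ((lc, b) : synt_config) ∈ aut.nodes)
    (hstep : smallStep ((lc, b), s) ((lc', b'), s')) :
    ((lc', b') : synt_config) ∈ aut.nodes ∧
      ta_step aut (((lc, b) : synt_config), s) (((lc', b') : synt_config), s') := by
  obtain ⟨himage, heffect⟩ := hstep.mem_synt_step_image_and_effect
  obtain ⟨hmem, hedge⟩ := hclosed _ hnode _ himage
  exact ⟨hmem, _, hedge, rfl, rfl, heffect⟩
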